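/- Let H be a real Hilbert space, g ∈ O₊(B), and p ∈ ℋ(H). Then the limit lim_{n→∞} (1/n)·d(gⁿ·p, p) exists, is independent of p, and equals the translation length ℓ(g) = inf_{y ∈ ℋ(H)} d(g·y, y). Equivalently, ℓ(g) = ln( lim_{n→∞} (B(gⁿ·p, p))^{1/n} ). -/

import Mathlib

open scoped RealInnerProductSpace

variable (H : Type*) [NormedAddCommGroup H] [InnerProductSpace ℝ H]

/-- The Minkowski bilinear form on `ℝ × H`. -/
noncomputable def minkB (v w : ℝ × H) : ℝ := v.1 * w.1 - ⟪v.2, w.2⟫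

/-- The hyperboloid model of hyperbolic space inside `ℝ × H`. -/
noncomputable def Hyp : Set (ℝ × H) := {v | minkB H v v = 1 ∧ 0 < v.1}

/-- Inverse hyperbolic cosine. -/
noncomputable def arcosh (x : ℝ) : ℝ := Real.log (x + Real.sqrt (x ^ 2 - 1))

/-- The hyperbolic distance on the hyperboloid. -/
noncomputable def hypDist (x y : ℝ × H) : ℝ := arcosh (minkB H x y)

/-- A subset of the hyperboloid is hyperbolically total if its closed linear span
is all of `ℝ × H`. -/
def HypTotal (S : Set (ℝ × H)) : Prop :=
  (Submodule.span ℝ S).topologicalClosure = ⊤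

/-- A kernel of hyperbolic type. -/
def IsHypKernel {X : Type*} (β : X → X → ℝ) : Prop :=
  (∀ x y, β x y = β y x) ∧ (∀ x y, 0 ≤ β x y) ∧ (∀ x, β x x = 1) ∧
    ∀ (n : ℕ) (x₀ : X) (x : Fin n → X) (c : Fin n → ℝ),
      ∑ i, ∑ j, c i * c j * β (x i) (x j) ≤ (∑ k, c k * β (x k) x₀) ^ 2

/-- A kernel of conditionally negative type. -/
def IsCNDKernel {X : Type*} (ψ : X → X → ℝ) : Prop :=
  (∀ x y, ψ x y = ψ y x) ∧ (∀ x, ψ x x = 0) ∧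
    ∀ (n : ℕ) (x : Fin n → X) (c : Fin n → ℝ), (∑ i, c i = 0) →
      ∑ i, ∑ j, c i * c j * ψ (x i) (x j) ≤ 0

/-- The group `O₊(B)` of continuous linear automorphisms of `ℝ × H` preserving the
Minkowski form and the upper hyperboloid sheet. -/
noncomputable def Oplus : Subgroup ((ℝ × H) ≃L[ℝ] (ℝ × H)) where
  carrier := {g | (∀ v w, minkB H (g v) (g w) = minkB H v w) ∧
    ∀ v, v ∈ Hyp H ↔ g v ∈ Hyp H}
  one_mem' := ⟨fun _ _ => rfl, fun _ => Iff.rfl⟩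
  mul_mem' := by
    rintro a b ⟨ha1, ha2⟩ ⟨hb1, hb2⟩
    refine ⟨fun v w => ?_, fun v => ?_⟩
    · show minkB H (a (b v)) (a (b w)) = _
      rw [ha1, hb1]
    · show v ∈ Hyp H ↔ a (b v) ∈ Hyp H
      rw [← ha2, ← hb2]
  inv_mem' := by
    rintro a ⟨ha1, ha2⟩
    refine ⟨fun v w => ?_, fun v => ?_⟩
    · show minkB H (a.symm v) (a.symm w) = minkB H v w
      conv_rhs => rw [← a.apply_symm_apply v, ← a.apply_symm_apply w, ha1]
    · show v ∈ Hyp H ↔ a.symm v ∈ Hyp H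
      conv_lhs => rw [← a.apply_symm_apply v, ← ha2]


section MinkowskiForm

variable {H}

lemma minkB_comm (v w : ℝ × H) : minkB H v w = minkB H w v := by
  simp only [minkB, real_inner_comm w.2 v.2, mul_comm v.1]

lemma minkB_add_left (u v w : ℝ × H) : minkB H (u + v) w = minkB H u w + minkB H v w := by
  simp only [minkB, Prod.fst_add, Prod.snd_add, inner_add_left]
  ring

lemma minkB_smul_left (t : ℝ) (v w : ℝ × H) : minkB H (t • v) w = t * minkB H v w := by
  simp only [minkB, Prod.smul_fst, Prod.smul_snd, real_inner_smul_left, smul_eq_mul]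
  ring

lemma minkB_add_right (u v w : ℝ × H) : minkB H u (v + w) = minkB H u v + minkB H u w := by
  rw [minkB_comm, minkB_add_left, minkB_comm v, minkB_comm w]

lemma minkB_smul_right (t : ℝ) (v w : ℝ × H) : minkB H v (t • w) = t * minkB H v w := by
  rw [minkB_comm, minkB_smul_left, minkB_comm w]

lemma norm_snd_sq_of_mem_Hyp {y : ℝ × H} (hy : y ∈ Hyp H) : ‖y.2‖ ^ 2 = y.1 ^ 2 - 1 := by
  have h := hy.1
  rw [minkB, real_inner_self_eq_norm_sq] at h
  linarith

lemma norm_snd_lt_fst_of_mem_Hyp {y : ℝ × H} (hy : y ∈ Hyp H) : ‖y.2‖ < y.1 :=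
  lt_of_pow_lt_pow_left₀ 2 hy.2.le (by linarith [norm_snd_sq_of_mem_Hyp hy])

/-- The Minkowski form is negative semidefinite on the orthogonal complement of a point of the
hyperboloid. -/
lemma minkB_self_nonpos_of_orthogonal {u y : ℝ × H} (hy : y ∈ Hyp H) (h : minkB H u y = 0) :
    minkB H u u ≤ 0 := by
  have hinner : u.1 * y.1 = ⟪u.2, y.2⟫ := sub_eq_zero.mp h
  have hcs : (u.1 * y.1) ^ 2 ≤ (‖u.2‖ * ‖y.2‖) ^ 2 := by
    rw [hinner]
    exact sq_le_sq.mpr ((abs_real_inner_le_norm _ _).trans (le_abs_self _))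
  rw [mul_pow, mul_pow, norm_snd_sq_of_mem_Hyp hy] at hcs
  have hle : u.1 ^ 2 ≤ ‖u.2‖ ^ 2 := by
    refine le_of_mul_le_mul_right ?_ (pow_pos hy.2 2)
    linarith [sq_nonneg ‖u.2‖]
  rw [minkB, real_inner_self_eq_norm_sq]
  linarith

lemma minkB_self_le_sq {y : ℝ × H} (hy : y ∈ Hyp H) (w : ℝ × H) :
    minkB H w w ≤ minkB H w y ^ 2 := by
  have h := minkB_self_nonpos_of_orthogonal (u := w + (-minkB H w y) • y) hy (by
    rw [minkB_add_left, minkB_smul_left, hy.1]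
    ring)
  simp only [minkB_add_left, minkB_add_right, minkB_smul_left, minkB_smul_right, hy.1,
    minkB_comm y w] at h
  linarith

lemma one_le_minkB {x y : ℝ × H} (hx : x ∈ Hyp H) (hy : y ∈ Hyp H) : 1 ≤ minkB H x y := by
  have hsq := minkB_self_le_sq hy x
  rw [hx.1] at hsq
  have hpos : 0 < minkB H x y := by
    have h₁ := real_inner_le_norm x.2 y.2
    have h₂ := mul_lt_mul'' (norm_snd_lt_fst_of_mem_Hyp hx) (norm_snd_lt_fst_of_mem_Hyp hy)
      (norm_nonneg _) (norm_nonneg _)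
    rw [minkB]
    linarith
  nlinarith

lemma minkB_sub_mul_sq_le {x y z : ℝ × H} (hx : x ∈ Hyp H) (hy : y ∈ Hyp H) (hz : z ∈ Hyp H) :
    (minkB H x z - minkB H x y * minkB H y z) ^ 2 ≤
      (minkB H x y ^ 2 - 1) * (minkB H y z ^ 2 - 1) := by
  have h := discrim_le_zero (a := minkB H x y ^ 2 - 1)
    (b := 2 * (minkB H x y * minkB H y z - minkB H x z)) (c := minkB H y z ^ 2 - 1) fun t => by
      have ht := minkB_self_le_sq hy (t • x + z)
      simp only [minkB_add_left, minkB_add_right, minkB_smul_left, minkB_smul_right, hx.1, hz.1,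
        minkB_comm z] at ht
      linarith
  rw [discrim] at h
  linarith

lemma hypDist_eq_arcosh (x y : ℝ × H) : hypDist H x y = Real.arcosh (minkB H x y) := rfl

lemma hypDist_comm (x y : ℝ × H) : hypDist H x y = hypDist H y x := by
  rw [hypDist, hypDist, minkB_comm]

lemma hypDist_nonneg {x y : ℝ × H} (hx : x ∈ Hyp H) (hy : y ∈ Hyp H) : 0 ≤ hypDist H x y :=
  Real.arcosh_nonneg (one_le_minkB hx hy)

lemma hypDist_self {x : ℝ × H} (hx : x ∈ Hyp H) : hypDist H x x = 0 := by
  rw [hypDist_eq_arcosh, hx.1, Real.arcosh_zero]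

lemma hypDist_triangle {x y z : ℝ × H} (hx : x ∈ Hyp H) (hy : y ∈ Hyp H) (hz : z ∈ Hyp H) :
    hypDist H x z ≤ hypDist H x y + hypDist H y z := by
  have hxy := one_le_minkB hx hy
  have hyz := one_le_minkB hy hz
  have hxz := one_le_minkB hx hz
  rw [← Real.arcosh_cosh (add_nonneg (hypDist_nonneg hx hy) (hypDist_nonneg hy hz)),
    hypDist_eq_arcosh x z, Real.arcosh_le_arcosh (by linarith) (Real.cosh_pos _), Real.cosh_add,
    hypDist_eq_arcosh, hypDist_eq_arcosh, Real.cosh_arcosh hxy, Real.cosh_arcosh hyz,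
    Real.sinh_arcosh hxy, Real.sinh_arcosh hyz, ← Real.sqrt_mul (by nlinarith)]
  linarith [Real.le_sqrt_of_sq_le (minkB_sub_mul_sq_le hx hy hz)]

lemma minkB_le_exp_hypDist {x y : ℝ × H} (hx : x ∈ Hyp H) (hy : y ∈ Hyp H) :
    minkB H x y ≤ Real.exp (hypDist H x y) := by
  rw [hypDist_eq_arcosh, Real.exp_arcosh (one_le_minkB hx hy)]
  linarith [Real.sqrt_nonneg (minkB H x y ^ 2 - 1)]

lemma exp_hypDist_le_two_mul_minkB {x y : ℝ × H} (hx : x ∈ Hyp H) (hy : y ∈ Hyp H) :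
    Real.exp (hypDist H x y) ≤ 2 * minkB H x y := by
  have h := one_le_minkB hx hy
  rw [hypDist_eq_arcosh, Real.exp_arcosh h]
  have hsqrt : √(minkB H x y ^ 2 - 1) ≤ minkB H x y :=
    Real.sqrt_le_iff.mpr ⟨by linarith, by linarith⟩
  linarith

end MinkowskiForm

section TranslationLength

variable {H}

lemma Oplus.minkB_map (g : Oplus H) (v w : ℝ × H) : minkB H (g.1 v) (g.1 w) = minkB H v w :=
  g.2.1 v w

lemma Oplus.map_mem_Hyp (g : Oplus H) {v : ℝ × H} (hv : v ∈ Hyp H) : g.1 v ∈ Hyp H :=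
  (g.2.2 v).mp hv

lemma Oplus.hypDist_map (g : Oplus H) (v w : ℝ × H) :
    hypDist H (g.1 v) (g.1 w) = hypDist H v w := by
  rw [hypDist, hypDist, Oplus.minkB_map g]

lemma Oplus.pow_add_apply (g : Oplus H) (m n : ℕ) (v : ℝ × H) :
    (g ^ (m + n)).1 v = (g ^ m).1 ((g ^ n).1 v) := by
  rw [pow_add]
  rfl

/-- The midpoint of `x` and `g x` is moved by `g` at most half as far as `x` is moved by `g ^ 2`. -/
lemma Oplus.exists_hypDist_le_half (g : Oplus H) {x : ℝ × H} (hx : x ∈ Hyp H) :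
    ∃ m ∈ Hyp H, hypDist H (g.1 m) m ≤ hypDist H (g.1 (g.1 x)) x / 2 := by
  have hgx := Oplus.map_mem_Hyp g hx
  have hggx := Oplus.map_mem_Hyp g hgx
  set b := minkB H (g.1 x) x with hb
  set c := minkB H (g.1 (g.1 x)) x with hc
  set D := hypDist H (g.1 (g.1 x)) x with hD
  have hb₁ : 1 ≤ b := one_le_minkB hgx hx
  have hc₁ : 1 ≤ c := one_le_minkB hggx hx
  set r := (√(2 * (1 + b)))⁻¹ with hr
  have hr₀ : 0 < r := inv_pos.mpr (Real.sqrt_pos.mpr (by linarith))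
  have hr₂ : r * r = (2 * (1 + b))⁻¹ := by
    rw [hr, ← mul_inv, Real.mul_self_sqrt (by linarith)]
  have hm : r • (x + g.1 x) ∈ Hyp H := by
    refine ⟨?_, mul_pos hr₀ (add_pos hx.2 hgx.2)⟩
    simp only [minkB_add_left, minkB_add_right, minkB_smul_left, minkB_smul_right, hx.1, hgx.1,
      minkB_comm x (g.1 x), ← hb]
    have hb₀ : 1 + b ≠ 0 := by linarith
    rw [← mul_add, ← mul_assoc, hr₂]
    field_simp
    ring
  refine ⟨_, hm, ?_⟩
  have hgm : minkB H (g.1 (r • (x + g.1 x))) (r • (x + g.1 x)) =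
      (2 * b + 1 + c) / (2 * (1 + b)) := by
    simp only [map_smul, map_add, minkB_add_left, minkB_add_right, minkB_smul_left,
      minkB_smul_right, Oplus.minkB_map g, hx.1, ← hb, ← hc]
    have hb₀ : 1 + b ≠ 0 := by linarith
    rw [← mul_add, ← mul_assoc, hr₂]
    field_simp
    ring
  have hcb : c ≤ 2 * b ^ 2 - 1 := by
    have h := minkB_sub_mul_sq_le hggx hgx hx
    rw [Oplus.minkB_map g, ← hb, ← hc, ← sq, ← sq] at h
    linarith [(abs_le_of_sq_le_sq' h (by nlinarith)).2]
  have hcosh : c = 2 * Real.cosh (D / 2) ^ 2 - 1 := by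
    have h := Real.cosh_two_mul (D / 2)
    rw [Real.sinh_sq, mul_div_cancel₀ _ two_ne_zero, hD, hypDist_eq_arcosh,
      Real.cosh_arcosh hc₁] at h
    rw [hD, hypDist_eq_arcosh]
    linarith
  have hD₀ : 0 ≤ D := hypDist_nonneg hggx hx
  have hs₁ := Real.one_le_cosh (D / 2)
  have hsb : Real.cosh (D / 2) ≤ b := by
    refine le_of_sq_le_sq ?_ (by linarith)
    linarith
  rw [hypDist_eq_arcosh, hgm, ← Real.arcosh_cosh (by linarith : 0 ≤ D / 2),
    Real.arcosh_le_arcosh (by positivity) (Real.cosh_pos _), div_le_iff₀ (by linarith)]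
  nlinarith [mul_nonneg (sub_nonneg.mpr hs₁) (sub_nonneg.mpr hsb)]

lemma bddBelow_range_hypDist_map (g : Oplus H) :
    BddBelow (Set.range fun y : Hyp H => hypDist H (g.1 (y : ℝ × H)) (y : ℝ × H)) :=
  ⟨0, by
    rintro _ ⟨y, rfl⟩
    exact hypDist_nonneg (Oplus.map_mem_Hyp g y.2) y.2⟩

lemma two_pow_mul_iInf_hypDist_le (g : Oplus H) (k : ℕ) {x : ℝ × H} (hx : x ∈ Hyp H) :
    2 ^ k * (⨅ y : Hyp H, hypDist H (g.1 (y : ℝ × H)) (y : ℝ × H)) ≤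
      hypDist H ((g ^ 2 ^ k).1 x) x := by
  induction k generalizing x with
  | zero => simpa using ciInf_le (bddBelow_range_hypDist_map g) ⟨x, hx⟩
  | succ k ih =>
    obtain ⟨m, hm, hle⟩ := Oplus.exists_hypDist_le_half (g ^ 2 ^ k) hx
    have h := ih hm
    rw [← Oplus.pow_add_apply, ← two_mul, ← pow_succ'] at hle
    rw [pow_succ']
    linarith

lemma subadditive_hypDist_pow (g : Oplus H) {p : ℝ × H} (hp : p ∈ Hyp H) :
    Subadditive fun n : ℕ => hypDist H ((g ^ n).1 p) p := fun m n => by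
  have h := hypDist_triangle (Oplus.map_mem_Hyp (g ^ (m + n)) hp)
    (Oplus.map_mem_Hyp (g ^ m) hp) hp
  rw [Oplus.pow_add_apply g, Oplus.hypDist_map] at h
  simp only [Oplus.pow_add_apply g]
  linarith

lemma hypDist_pow_le (g : Oplus H) (n : ℕ) {y : ℝ × H} (hy : y ∈ Hyp H) :
    hypDist H ((g ^ n).1 y) y ≤ n * hypDist H (g.1 y) y := by
  induction n with
  | zero => simpa using! (hypDist_self hy).le
  | succ n ih =>
    have h := subadditive_hypDist_pow g hy n 1
    simp only [pow_one] at h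
    rw [Nat.cast_succ]
    linarith

lemma hypDist_pow_le_add (g : Oplus H) (n : ℕ) {p y : ℝ × H} (hp : p ∈ Hyp H) (hy : y ∈ Hyp H) :
    hypDist H ((g ^ n).1 p) p ≤ 2 * hypDist H p y + n * hypDist H (g.1 y) y := by
  have hgp := Oplus.map_mem_Hyp (g ^ n) hp
  have hgy := Oplus.map_mem_Hyp (g ^ n) hy
  have h₁ := hypDist_triangle hgp hgy hp
  have h₂ := hypDist_triangle hgy hy hp
  rw [Oplus.hypDist_map] at h₁
  rw [hypDist_comm y p] at h₂
  linarith [hypDist_pow_le g n hy]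

open Filter Topology

lemma tendsto_hypDist_pow_div (g : Oplus H) {p : ℝ × H} (hp : p ∈ Hyp H) :
    Tendsto (fun n : ℕ => hypDist H ((g ^ n).1 p) p / n) atTop
      (𝓝 (⨅ y : Hyp H, hypDist H (g.1 (y : ℝ × H)) (y : ℝ × H))) := by
  have hsub := subadditive_hypDist_pow g hp
  have hlim := hsub.tendsto_lim ⟨0, by
    rintro _ ⟨n, rfl⟩
    exact div_nonneg (hypDist_nonneg (Oplus.map_mem_Hyp (g ^ n) hp) hp) n.cast_nonneg⟩
  have : Nonempty (Hyp H) := ⟨⟨p, hp⟩⟩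
  suffices h : hsub.lim = ⨅ y : Hyp H, hypDist H (g.1 (y : ℝ × H)) (y : ℝ × H) by rwa [h] at hlim
  apply le_antisymm
  · refine le_ciInf fun y => ?_
    have hbound : Tendsto (fun n : ℕ => 2 * hypDist H p y / n + hypDist H (g.1 y) y) atTop
        (𝓝 (hypDist H (g.1 y) y)) := by
      simpa using (tendsto_const_div_atTop_nhds_zero_nat (2 * hypDist H p y)).add_const
        (hypDist H (g.1 y) y)
    refine le_of_tendsto_of_tendsto hlim hbound ?_
    filter_upwards [eventually_gt_atTop 0] with n hn
    have hn' : (0 : ℝ) < n := Nat.cast_pos.mpr hn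
    rw [div_add' _ _ _ hn'.ne', div_le_div_iff_of_pos_right hn', mul_comm _ (n : ℝ)]
    exact hypDist_pow_le_add g n hp y.2
  · refine ge_of_tendsto' (hlim.comp (tendsto_pow_atTop_atTop_of_one_lt one_lt_two)) fun k => ?_
    simp only [Function.comp_apply]
    rw [le_div_iff₀ (by positivity), mul_comm]
    exact_mod_cast two_pow_mul_iInf_hypDist_le g k hp

lemma tendsto_minkB_pow_rpow (g : Oplus H) {p : ℝ × H} (hp : p ∈ Hyp H) :
    Tendsto (fun n : ℕ => minkB H ((g ^ n).1 p) p ^ ((1 : ℝ) / n)) atTop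
      (𝓝 (Real.exp (⨅ y : Hyp H, hypDist H (g.1 (y : ℝ × H)) (y : ℝ × H)))) := by
  have hdist := tendsto_hypDist_pow_div g hp
  have hone (n : ℕ) : 1 ≤ minkB H ((g ^ n).1 p) p :=
    one_le_minkB (Oplus.map_mem_Hyp (g ^ n) hp) hp
  have hlog : Tendsto (fun n : ℕ => Real.log (minkB H ((g ^ n).1 p) p) / n) atTop
      (𝓝 (⨅ y : Hyp H, hypDist H (g.1 (y : ℝ × H)) (y : ℝ × H))) := by
    have hlow := hdist.sub (tendsto_const_div_atTop_nhds_zero_nat (Real.log 2))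
    rw [sub_zero] at hlow
    refine tendsto_of_tendsto_of_tendsto_of_le_of_le hlow hdist (fun n => ?_) fun n => ?_
    · have h := exp_hypDist_le_two_mul_minkB (Oplus.map_mem_Hyp (g ^ n) hp) hp
      rw [← Real.le_log_iff_exp_le (by linarith [hone n]),
        Real.log_mul two_ne_zero (by linarith [hone n])] at h
      simp only [← sub_div]
      gcongr
      linarith
    · have h := minkB_le_exp_hypDist (Oplus.map_mem_Hyp (g ^ n) hp) hp
      rw [← Real.log_le_iff_le_exp (by linarith [hone n])] at h
      exact div_le_div_of_nonneg_right h n.cast_nonneg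
  refine ((Real.continuous_exp.tendsto _).comp hlog).congr fun n => ?_
  rw [Function.comp_apply, Real.rpow_def_of_pos (by linarith [hone n]), mul_one_div]

end TranslationLength

/-- for every `g ∈ O₊(B)` and every `p` on the hyperboloid,
`d(gⁿ p, p)/n` converges to the translation length `ℓ(g) = inf_y d(g y, y)`
(a value independent of `p`); equivalently `B(gⁿ p, p)^{1/n} → exp ℓ(g)`. -/
theorem translation_length_limit
    (H : Type*) [NormedAddCommGroup H] [InnerProductSpace ℝ H] [CompleteSpace H]
    (g : Oplus H) (p : ℝ × H) (hp : p ∈ Hyp H) :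
    Filter.Tendsto (fun n : ℕ => hypDist H ((g ^ n).1 p) p / n) Filter.atTop
      (nhds (⨅ y : Hyp H, hypDist H (g.1 (y : ℝ × H)) (y : ℝ × H))) ∧
    Filter.Tendsto (fun n : ℕ => (minkB H ((g ^ n).1 p) p) ^ ((1 : ℝ) / n)) Filter.atTop
      (nhds (Real.exp (⨅ y : Hyp H, hypDist H (g.1 (y : ℝ × H)) (y : ℝ × H)))) :=
  ⟨tendsto_hypDist_pow_div g hp, tendsto_minkB_pow_rpow g hp⟩
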